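/- arXiv:2505.06839 — 3 statements merged into one kernel-verified Lean document; each statement's English description precedes it below -/
import Mathlib

section
/- There exists a universal constant C > 0 such that the following holds. Let μ be either the Gaussian measure N(0, I_d/d) on ℝ^d or the uniform measure on the unit ball B_d, and let U ⊆ ℝ^d be a measurable set with μ(U) > 0. Let Σ_U be the covariance matrix of the distribution μ conditioned on U. Then for any κ ≥ C·(1 + log(1/μ(U))), the eigenvalues of Σ_U in decreasing order satisfy λ_{d−κ+1}(Σ_U) ≥ 1/(30000·d). -/
open MeasureTheory ProbabilityTheory Matrix
open scoped ENNReal NNReal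

noncomputable section

/-- The Gaussian measure `N(0, I_d/d)` on `ℝ^d`: product of `d` i.i.d. centered Gaussians of
variance `1/d`. -/
def stdGaussianScaled (d : ℕ) : Measure (Fin d → ℝ) :=
  Measure.pi fun _ => gaussianReal 0 ((d : ℝ≥0))⁻¹

/-- The Euclidean unit ball in `ℝ^d`. -/
def unitBall (d : ℕ) : Set (Fin d → ℝ) := {x | ∑ i, (x i) ^ 2 ≤ 1}

/-- The uniform probability measure on the Euclidean unit ball of `ℝ^d`. -/
def uniformBall (d : ℕ) : Measure (Fin d → ℝ) :=
  (volume (unitBall d))⁻¹ • volume.restrict (unitBall d)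

/-- The mean of `μ` conditioned on `U`. -/
def condMean {d : ℕ} (μ : Measure (Fin d → ℝ)) (U : Set (Fin d → ℝ)) : Fin d → ℝ :=
  fun i => ∫ x, x i ∂(ProbabilityTheory.cond μ U)

/-- The covariance matrix `Σ_U` of `μ` conditioned on `U`:
`Σ_U = E[XXᵀ] − E[X]E[X]ᵀ` for `X ∼ μ|_U`. -/
def covMatrix {d : ℕ} (μ : Measure (Fin d → ℝ)) (U : Set (Fin d → ℝ)) :
    Matrix (Fin d) (Fin d) ℝ :=
  Matrix.of fun i j =>
    (∫ x, x i * x j ∂(ProbabilityTheory.cond μ U)) - condMean μ U i * condMean μ U j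

lemma covMatrix_isHermitian {d : ℕ} (μ : Measure (Fin d → ℝ)) (U : Set (Fin d → ℝ)) :
    (covMatrix μ U).IsHermitian := by
  unfold Matrix.IsHermitian
  ext i j
  simp only [Matrix.conjTranspose_apply, covMatrix, Matrix.of_apply, star_trivial]
  rw [mul_comm (condMean μ U j)]
  congr 1
  simp_rw [mul_comm]

lemma aux_pi_gauss (d : ℕ) (hd : 0 < d) :
    stdGaussianScaled d = (volume : Measure (Fin d → ℝ)).withDensity
      (fun x => ∏ i, gaussianPDF 0 ((d : ℝ≥0))⁻¹ (x i)) := by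
  have hv : ((d : ℝ≥0))⁻¹ ≠ 0 := by positivity
  unfold stdGaussianScaled
  refine Measure.pi_eq ?_
  intro s hs
  rw [withDensity_apply _ (MeasurableSet.univ_pi hs), ← lintegral_indicator (MeasurableSet.univ_pi hs)]
  have h1 : ∀ x : Fin d → ℝ, (Set.univ.pi s).indicator
      (fun x => ∏ i, gaussianPDF 0 ((d : ℝ≥0))⁻¹ (x i)) x
      = ENNReal.ofReal (∏ i, (s i).indicator (gaussianPDFReal 0 ((d : ℝ≥0))⁻¹) (x i)) := by
    intro x
    by_cases hx : x ∈ Set.univ.pi s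
    · rw [Set.indicator_of_mem hx, ENNReal.ofReal_prod_of_nonneg]
      · refine Finset.prod_congr rfl fun i _ => ?_
        rw [Set.indicator_of_mem (hx i trivial)]; rfl
      · intro i _
        exact Set.indicator_nonneg (fun _ _ => gaussianPDFReal_nonneg _ _ _) _
    · rw [Set.indicator_of_notMem hx]
      simp only [Set.mem_pi, Set.mem_univ, true_imp_iff, not_forall] at hx
      obtain ⟨i, hi⟩ := hx
      rw [Finset.prod_eq_zero (Finset.mem_univ i) (Set.indicator_of_notMem hi _)]
      simp
  simp_rw [h1]
  rw [← ofReal_integral_eq_lintegral_ofReal]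
  · rw [integral_fintype_prod_volume_eq_prod
      (fun i => (s i).indicator (gaussianPDFReal 0 ((d : ℝ≥0))⁻¹)), ENNReal.ofReal_prod_of_nonneg]
    · refine Finset.prod_congr rfl fun i _ => ?_
      rw [gaussianReal_apply_eq_integral _ hv, integral_indicator (hs i)]
    · intro i _
      exact integral_nonneg fun x => Set.indicator_nonneg (fun _ _ => gaussianPDFReal_nonneg _ _ _) _
  · exact Integrable.fintype_prod (f := fun i => (s i).indicator (gaussianPDFReal 0 ((d : ℝ≥0))⁻¹))
      (fun i => (integrable_gaussianPDFReal _ _).indicator (hs i))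
  · exact Filter.Eventually.of_forall fun x => Finset.prod_nonneg fun i _ =>
      Set.indicator_nonneg (fun _ _ => gaussianPDFReal_nonneg _ _ _) _

lemma aux_tau (d k : ℕ) (hk : k ≤ d) (hd : 0 < d) :
    Real.exp (-(k : ℝ)) ≤ (1 - (k : ℝ) / d) ^ (d - k) ∧ 0 < (1 - (k : ℝ) / d) ^ (d - k) := by
  have key : Real.exp (-(k : ℝ)) ≤ (1 - (k : ℝ) / d) ^ (d - k) := by
    rcases hk.eq_or_lt with h | h
    · subst h; simp
    · obtain ⟨n, rfl⟩ := Nat.exists_eq_add_of_lt h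
      have e : k + n + 1 - k = n + 1 := by omega
      rw [e]
      push_cast
      have hn : (0 : ℝ) < n + 1 := by positivity
      have h2 := Real.add_one_le_exp ((k : ℝ) / (n + 1))
      have h3 : (1 - (k : ℝ) / (k + n + 1)) = ((k : ℝ) / (n + 1) + 1)⁻¹ := by
        field_simp; ring
      rw [h3, inv_pow, Real.exp_neg]
      gcongr
      calc ((k : ℝ) / (n + 1) + 1) ^ (n + 1) ≤ (Real.exp ((k : ℝ) / (n + 1))) ^ (n + 1) := by gcongr
        _ = Real.exp k := by
          rw [← Real.exp_nat_mul]; congr 1; push_cast; field_simp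
  exact ⟨key, (Real.exp_pos _).trans_le key⟩

lemma aux_lintegral (d : ℕ) (g : (Fin d → ℝ) → ℝ≥0∞) (hg : Measurable g)
    (M : Matrix (Fin d) (Fin d) ℝ) (hM : M.det ≠ 0) (c : Fin d → ℝ) :
    ∫⁻ x, g (M *ᵥ x - c) = ENNReal.ofReal |M.det⁻¹| * ∫⁻ x, g x := by
  have h := Real.map_matrix_volume_pi_eq_smul_volume_pi hM
  have h2 : ∫⁻ y, g (y - c) ∂(Measure.map (toLin' M) volume) = ∫⁻ x, g (M *ᵥ x - c) := by
    have hm : Measurable (fun y : Fin d → ℝ => g (y - c)) := hg.comp (measurable_id.sub_const c)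
    rw [lintegral_map hm (LinearMap.continuous_of_finiteDimensional (toLin' M)).measurable]
    simp [toLin'_apply]
  rw [← h2, h, lintegral_smul_measure, lintegral_sub_right_eq_self (fun y => g y) c]
  simp

lemma aux_smallball (d : ℕ) (hd : 0 < d) (g : (Fin d → ℝ) → ℝ≥0∞) (hg : Measurable g)
    (hg1 : ∫⁻ x, g x ≤ 1) (W : Matrix (Fin d) (Fin d) ℝ) (hW : W * Wᵀ = 1)
    (hdec : ∀ x y : Fin d → ℝ, ∀ k : ℕ, k ≤ d →
      ∑ i, y i ^ 2 ≤ k / d + (1 - (k : ℝ) / d) * ∑ i, x i ^ 2 →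
      g x ≤ ENNReal.ofReal (Real.exp k) * g y)
    (S : Finset (Fin d)) (b : Fin d → ℝ) :
    volume.withDensity g {x | ∑ i ∈ S, ((W *ᵥ x) i - b i) ^ 2 ≤ (S.card : ℝ) / (15000 * d)}
      ≤ ENNReal.ofReal (Real.exp (-(S.card : ℝ))) := by
  classical
  set k := S.card with hkdef
  have hk : k ≤ d := by simpa using S.card_le_univ
  obtain ⟨ht1, ht2⟩ := aux_tau d k hk hd
  set τ : ℝ := 1 - (k : ℝ) / d with hτ
  have hdR : (0 : ℝ) < d := by exact_mod_cast hd
  have hkd : (k : ℝ) / d ≤ 1 := by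
    rw [div_le_one hdR]; exact_mod_cast hk
  have hτ0 : 0 ≤ τ := by rw [hτ]; linarith
  have hτ1 : τ ≤ 1 := by rw [hτ]; have : 0 ≤ (k : ℝ) / d := by positivity
                         linarith
  let D : Fin d → ℝ := fun i => if i ∈ S then 100 else τ
  let M := diagonal D * W
  let c : Fin d → ℝ := fun i => if i ∈ S then 100 * b i else 0
  have hprod : ∏ i, D i = 100 ^ k * τ ^ (d - k) := by
    simp only [D]
    rw [Finset.prod_ite]
    simp [Finset.filter_not, Finset.card_sdiff, hkdef]
  have hWdet : |W.det| = 1 := by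
    have := congrArg Matrix.det hW
    rw [det_mul, det_transpose, det_one] at this
    rcases mul_self_eq_one_iff.1 this with h | h <;> simp [h]
  have hdet : |M.det| = 100 ^ k * τ ^ (d - k) := by
    simp only [M]
    rw [det_mul, det_diagonal, abs_mul, hWdet, mul_one, hprod, abs_of_nonneg (by positivity)]
  have hM : M.det ≠ 0 := by
    rw [← abs_pos, hdet]; positivity
  have hMx : ∀ x i, (M *ᵥ x - c) i = if i ∈ S then 100 * ((W *ᵥ x) i - b i) else τ * (W *ᵥ x) i := by
    intro x i
    simp only [M, c, D, ← mulVec_mulVec, Pi.sub_apply, mulVec_diagonal]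
    split_ifs <;> ring
  have hWx : ∀ x, ∑ i, (W *ᵥ x) i ^ 2 = ∑ i, x i ^ 2 := by
    intro x
    have h1 : ∀ v : Fin d → ℝ, ∑ i, v i ^ 2 = v ⬝ᵥ v := fun v => by
      simp [dotProduct, sq]
    have hW' : Wᵀ * W = 1 := mul_eq_one_comm.1 hW
    rw [h1, h1, dotProduct_mulVec, ← mulVec_transpose, mulVec_mulVec, hW', one_mulVec]
  have hA : MeasurableSet {x : Fin d → ℝ | ∑ i ∈ S, ((W *ᵥ x) i - b i) ^ 2 ≤ (k : ℝ) / (15000 * d)} := by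
    apply measurableSet_le _ measurable_const
    simp only [mulVec, dotProduct]
    fun_prop
  have hmain : ∀ x ∈ {x : Fin d → ℝ | ∑ i ∈ S, ((W *ᵥ x) i - b i) ^ 2 ≤ (k : ℝ) / (15000 * d)},
      g x ≤ ENNReal.ofReal (Real.exp k) * g (M *ᵥ x - c) := by
    intro x hx
    apply hdec x _ k hk
    simp only [Set.mem_ofPred_eq] at hx
    have hsplit : ∀ f : Fin d → ℝ, ∑ i, f i = ∑ i ∈ S, f i + ∑ i ∈ Sᶜ, f i :=
      fun f => (Finset.sum_add_sum_compl S f).symm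
    rw [hsplit]
    have e1 : ∑ i ∈ S, (M *ᵥ x - c) i ^ 2 ≤ k / d := by
      calc _ = 10000 * ∑ i ∈ S, ((W *ᵥ x) i - b i) ^ 2 := by
            rw [Finset.mul_sum]
            refine Finset.sum_congr rfl fun i hi => ?_
            rw [hMx, if_pos hi]; ring
        _ ≤ 10000 * ((k : ℝ) / (15000 * d)) := by gcongr
        _ = (10000 / 15000) * (k / d) := by field_simp
        _ ≤ 1 * (k / d) := by gcongr; norm_num
        _ = _ := one_mul _
    have e2 : ∑ i ∈ Sᶜ, (M *ᵥ x - c) i ^ 2 ≤ τ * ∑ i, x i ^ 2 := by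
      calc _ = τ ^ 2 * ∑ i ∈ Sᶜ, ((W *ᵥ x) i) ^ 2 := by
            rw [Finset.mul_sum]
            refine Finset.sum_congr rfl fun i hi => ?_
            rw [hMx, if_neg (Finset.mem_compl.1 hi)]; ring
        _ ≤ τ * ∑ i, ((W *ᵥ x) i) ^ 2 := by
            apply mul_le_mul _ _ (Finset.sum_nonneg fun _ _ => sq_nonneg _) hτ0
            · nlinarith
            · exact Finset.sum_le_sum_of_subset_of_nonneg (Finset.subset_univ _)
                fun _ _ _ => sq_nonneg _
        _ = _ := by rw [hWx]
    linarith
  rw [withDensity_apply _ hA]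
  calc _ ≤ ∫⁻ x in {x : Fin d → ℝ | ∑ i ∈ S, ((W *ᵥ x) i - b i) ^ 2 ≤ (k : ℝ) / (15000 * d)},
          ENNReal.ofReal (Real.exp k) * g (M *ᵥ x - c) := setLIntegral_mono' hA hmain
    _ ≤ ∫⁻ x, ENNReal.ofReal (Real.exp k) * g (M *ᵥ x - c) := setLIntegral_le_lintegral _ _
    _ = ENNReal.ofReal (Real.exp k) * (ENNReal.ofReal |M.det⁻¹| * ∫⁻ x, g x) := by
        rw [lintegral_const_mul', aux_lintegral d g hg M hM c]
        exact ENNReal.ofReal_ne_top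
    _ ≤ ENNReal.ofReal (Real.exp k) * (ENNReal.ofReal |M.det⁻¹| * 1) := by gcongr
    _ = ENNReal.ofReal (Real.exp k * |M.det⁻¹|) := by
        rw [mul_one, ENNReal.ofReal_mul (Real.exp_pos _).le]
    _ ≤ _ := by
        apply ENNReal.ofReal_le_ofReal
        rw [abs_inv, hdet, ← div_eq_mul_inv, div_le_iff₀ (by positivity)]
        have h3 : Real.exp 1 < 2.7182818286 := Real.exp_one_lt_d9
        have h4 : Real.exp (3 * k) ≤ 100 ^ k := by
          have : Real.exp (3 * k) = (Real.exp 1 ^ 3) ^ k := by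
            rw [← pow_mul, ← Real.exp_nat_mul]; push_cast; ring_nf
          rw [this]
          gcongr
          calc Real.exp 1 ^ 3 ≤ 3 ^ 3 := by gcongr; linarith
            _ ≤ 100 := by norm_num
        calc Real.exp k = Real.exp (-k) * (Real.exp (3 * k) * Real.exp (-k)) := by
              rw [← Real.exp_add, ← Real.exp_add]; congr 1; ring
          _ ≤ _ := by gcongr

lemma aux_ball_univ (d : ℕ) : uniformBall d Set.univ ≤ 1 := by
  simp only [uniformBall, Measure.smul_apply, Measure.restrict_apply_univ, smul_eq_mul]
  exact ENNReal.inv_mul_le_one _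

lemma aux_ball_meas (d : ℕ) : MeasurableSet (unitBall d) := by
  unfold unitBall
  apply measurableSet_le _ measurable_const
  fun_prop

lemma aux_ball_density (d : ℕ) : uniformBall d = (volume : Measure (Fin d → ℝ)).withDensity
    ((unitBall d).indicator fun _ => (volume (unitBall d))⁻¹) := by
  rw [withDensity_indicator (aux_ball_meas d), withDensity_const]
  rfl

lemma aux_ball_dec (d : ℕ) : ∀ x y : Fin d → ℝ, ∀ k : ℕ, k ≤ d →
      ∑ i, y i ^ 2 ≤ k / d + (1 - (k : ℝ) / d) * ∑ i, x i ^ 2 →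
      (unitBall d).indicator (fun _ => (volume (unitBall d))⁻¹) x ≤ ENNReal.ofReal (Real.exp k) *
      (unitBall d).indicator (fun _ => (volume (unitBall d))⁻¹) y := by
  intro x y k hk h
  by_cases hx : x ∈ unitBall d
  · have hy : y ∈ unitBall d := by
      simp only [unitBall, Set.mem_ofPred_eq] at hx ⊢
      have : (k : ℝ) / d ≤ 1 := div_le_one_of_le₀ (by exact_mod_cast hk) (by positivity)
      nlinarith
    rw [Set.indicator_of_mem hx, Set.indicator_of_mem hy]
    refine le_mul_of_one_le_left zero_le ?_
    rw [ENNReal.one_le_ofReal]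
    exact Real.one_le_exp (by positivity)
  · rw [Set.indicator_of_notMem hx]; exact zero_le

lemma aux_gauss_dec (d : ℕ) (hd : 0 < d) : ∀ x y : Fin d → ℝ, ∀ k : ℕ, k ≤ d →
      ∑ i, y i ^ 2 ≤ k / d + (1 - (k : ℝ) / d) * ∑ i, x i ^ 2 →
      ∏ i, gaussianPDF 0 ((d : ℝ≥0))⁻¹ (x i) ≤ ENNReal.ofReal (Real.exp k) *
      ∏ i, gaussianPDF 0 ((d : ℝ≥0))⁻¹ (y i) := by
  intro x y k hk h
  have hdR : (0 : ℝ) < d := by exact_mod_cast hd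
  simp only [gaussianPDF]
  rw [← ENNReal.ofReal_prod_of_nonneg (fun _ _ => gaussianPDFReal_nonneg _ _ _),
    ← ENNReal.ofReal_prod_of_nonneg (fun _ _ => gaussianPDFReal_nonneg _ _ _),
    ← ENNReal.ofReal_mul (Real.exp_pos _).le]
  apply ENNReal.ofReal_le_ofReal
  simp only [gaussianPDFReal, Finset.prod_mul_distrib]
  rw [mul_left_comm, ← Real.exp_sum, ← Real.exp_sum, ← Real.exp_add]
  refine mul_le_mul_of_nonneg_left ?_ (Finset.prod_nonneg fun _ _ => by positivity)
  apply Real.exp_le_exp.2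
  have e : ∀ z : Fin d → ℝ, ∑ i, -(z i - 0) ^ 2 / (2 * (((d : ℝ≥0)⁻¹ : ℝ≥0) : ℝ))
      = - (d / 2) * ∑ i, z i ^ 2 := by
    intro z
    rw [Finset.mul_sum]
    refine Finset.sum_congr rfl fun i _ => ?_
    push_cast
    field_simp
    ring
  rw [e, e]
  have hx0 : 0 ≤ ∑ i, x i ^ 2 := Finset.sum_nonneg fun _ _ => sq_nonneg _
  have h0 : 0 ≤ (k : ℝ) / d := by positivity
  have h2 : ∑ i, y i ^ 2 ≤ k / d + ∑ i, x i ^ 2 := by nlinarith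
  have h3 := mul_le_mul_of_nonneg_left h2 hdR.le
  have h4 : (d : ℝ) * (k / d) = k := by field_simp
  have h5 : (0 : ℝ) ≤ k := by positivity
  nlinarith

lemma aux_gauss_memLp (d : ℕ) (i : Fin d) :
    MemLp (fun x : Fin d → ℝ => x i) 2 (stdGaussianScaled d) := by
  have h := memLp_id_gaussianReal' (μ := 0) (v := ((d : ℝ≥0))⁻¹) 2 (by simp)
  exact h.comp_measurePreserving
    (measurePreserving_eval (fun _ : Fin d => gaussianReal 0 ((d : ℝ≥0))⁻¹) i)

lemma aux_ball_memLp (d : ℕ) (i : Fin d) :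
    MemLp (fun x : Fin d → ℝ => x i) 2 (uniformBall d) := by
  haveI : IsFiniteMeasure (uniformBall d) := ⟨(aux_ball_univ d).trans_lt ENNReal.one_lt_top⟩
  refine MemLp.of_bound (measurable_pi_apply i).aestronglyMeasurable 1 ?_
  unfold uniformBall
  refine Measure.ae_smul_measure ?_ _
  rw [ae_restrict_iff' (aux_ball_meas d)]
  refine Filter.Eventually.of_forall fun x hx => ?_
  simp only [unitBall, Set.mem_ofPred_eq] at hx
  have := Finset.single_le_sum (f := fun i => x i ^ 2) (fun i _ => sq_nonneg _) (Finset.mem_univ i)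
  rw [Real.norm_eq_abs, ← sq_le_one_iff_abs_le_one]
  exact this.trans hx

lemma aux_core (d : ℕ) (hd : 0 < d) (μ : Measure (Fin d → ℝ)) (h1 : μ Set.univ ≤ 1)
    (hL : ∀ i, MemLp (fun x : Fin d → ℝ => x i) 2 μ)
    (hsb : ∀ W : Matrix (Fin d) (Fin d) ℝ, W * Wᵀ = 1 → ∀ (S : Finset (Fin d)) (b : Fin d → ℝ),
      μ {x | ∑ i ∈ S, ((W *ᵥ x) i - b i) ^ 2 ≤ (S.card : ℝ) / (15000 * d)}
        ≤ ENNReal.ofReal (Real.exp (-(S.card : ℝ))))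
    (U : Set (Fin d → ℝ)) (hU : MeasurableSet U) (hμU : 0 < μ U) (κ : ℕ)
    (hκ : (κ : ℝ) ≥ 1 * (1 + Real.log (1 / (μ U).toReal))) :
    d + 1 - κ ≤ Nat.card {i : Fin d //
      1 / (30000 * (d : ℝ)) ≤ (covMatrix_isHermitian μ U).eigenvalues i} := by
  classical
  have hdR : (0 : ℝ) < d := by exact_mod_cast hd
  haveI : IsFiniteMeasure μ := ⟨h1.trans_lt ENNReal.one_lt_top⟩
  set ν := ProbabilityTheory.cond μ U with hν
  haveI : IsProbabilityMeasure ν := cond_isProbabilityMeasure hμU.ne'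
  have hLν : ∀ i, MemLp (fun x : Fin d → ℝ => x i) 2 ν := by
    intro i
    exact ((hL i).restrict U).smul_measure (ENNReal.inv_ne_top.2 hμU.ne')
  have hint2 : ∀ i j, Integrable (fun x : Fin d → ℝ => x i * x j) ν :=
    fun i j => (hLν i).integrable_mul (hLν j)
  have hint1 : ∀ i, Integrable (fun x : Fin d → ℝ => x i) ν :=
    fun i => (hLν i).integrable (by norm_num)
  set hA := covMatrix_isHermitian μ U with hAdef
  let W : Matrix (Fin d) (Fin d) ℝ := Matrix.of fun i j => hA.eigenvectorBasis i j
  have hW : W * Wᵀ = 1 := by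
    ext i j
    have := orthonormal_iff_ite.1 hA.eigenvectorBasis.orthonormal j i
    rw [EuclideanSpace.inner_eq_star_dotProduct] at this
    simp only [mul_apply, transpose_apply, W, of_apply, one_apply]
    simp only [dotProduct, star_trivial] at this
    rw [this]
    simp only [eq_comm]
  have hw : ∀ i x, (W *ᵥ x) i = ∑ a, W i a * x a := fun i x => rfl
  have hwL : ∀ i, MemLp (fun x => (W *ᵥ x) i) 2 ν := by
    intro i
    simp only [hw]
    exact memLp_finsetSum _ fun a _ => (hLν a).const_mul _
  let b : Fin d → ℝ := fun i => ∫ x, (W *ᵥ x) i ∂ν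
  have hb : ∀ i, b i = ∑ a, W i a * condMean μ U a := by
    intro i
    simp only [b, hw]
    rw [integral_finsetSum _ fun a _ => (hint1 a).const_mul _]
    simp only [integral_const_mul, condMean, hν]
  have hsqint : ∀ i, Integrable (fun x => ((W *ᵥ x) i - b i) ^ 2) ν :=
    fun i => ((hwL i).sub (memLp_const (b i))).integrable_sq
  have heig : ∀ i, hA.eigenvalues i = ∫ x, ((W *ᵥ x) i - b i) ^ 2 ∂ν := by
    intro i
    have e1 : hA.eigenvalues i = ∑ a, W i a * ∑ c, covMatrix μ U a c * W i c := by
      rw [hA.eigenvalues_eq i]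
      simp only [dotProduct, mulVec, W, of_apply, RCLike.re_to_real, star_trivial, Pi.star_apply]
    have e2 : ∫ x, (W *ᵥ x) i ^ 2 ∂ν = ∑ a, W i a * ∑ c, (∫ x, x a * x c ∂ν) * W i c := by
      have : ∀ x, (W *ᵥ x) i ^ 2 = ∑ a, ∑ c, (W i a * W i c) * (x a * x c) := by
        intro x
        rw [hw, sq, Finset.sum_mul_sum]
        refine Finset.sum_congr rfl fun a _ => Finset.sum_congr rfl fun c _ => by ring
      simp only [this]
      rw [integral_finsetSum _ fun a _ => integrable_finsetSum _ fun c _ => (hint2 a c).const_mul _]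
      refine Finset.sum_congr rfl fun a _ => ?_
      rw [integral_finsetSum _ fun c _ => (hint2 a c).const_mul _, Finset.mul_sum]
      refine Finset.sum_congr rfl fun c _ => ?_
      rw [integral_const_mul]; ring
    have e3 : ∫ x, ((W *ᵥ x) i - b i) ^ 2 ∂ν = ∫ x, (W *ᵥ x) i ^ 2 ∂ν - b i ^ 2 := by
      have : ∀ x, ((W *ᵥ x) i - b i) ^ 2 = (W *ᵥ x) i ^ 2 - (2 * b i) * (W *ᵥ x) i + b i ^ 2 :=
        fun x => by ring
      simp only [this]
      have i1 := (hwL i).integrable_sq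
      have i2 := ((hwL i).integrable (by norm_num)).const_mul (2 * b i)
      have i3 : Integrable (fun x => (W *ᵥ x) i ^ 2 - (2 * b i) * (W *ᵥ x) i) ν := i1.sub i2
      rw [integral_add i3 (integrable_const _), integral_sub i1 i2, integral_const_mul]
      simp only [integral_const, probReal_univ, one_smul]
      change _ - 2 * b i * b i + _ = _
      ring
    rw [e3, e2, e1, hb, sq, Finset.sum_mul_sum, ← Finset.sum_sub_distrib]
    refine Finset.sum_congr rfl fun a _ => ?_
    rw [Finset.mul_sum, Finset.mul_sum, ← Finset.sum_sub_distrib]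
    refine Finset.sum_congr rfl fun c _ => ?_
    simp only [covMatrix, of_apply]
    ring
  let S : Finset (Fin d) := Finset.univ.filter fun i => ¬ (1 / (30000 * (d : ℝ)) ≤ hA.eigenvalues i)
  set k := S.card with hk
  have hcard : Nat.card {i : Fin d // 1 / (30000 * (d : ℝ)) ≤ hA.eigenvalues i} + k = d := by
    rw [Nat.card_eq_fintype_card, Fintype.card_subtype]
    have := Finset.card_filter_add_card_filter_not (s := (Finset.univ : Finset (Fin d)))
      (fun i => 1 / (30000 * (d : ℝ)) ≤ hA.eigenvalues i)
    rw [Finset.card_univ, Fintype.card_fin] at this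
    exact this
  suffices hlt : k < κ by omega
  have hUfin : μ U ≠ ∞ := measure_ne_top _ _
  have hp0 : 0 < (μ U).toReal := ENNReal.toReal_pos hμU.ne' hUfin
  have hp1 : (μ U).toReal ≤ 1 :=
    ENNReal.toReal_le_of_le_ofReal zero_le_one
      (by simpa using (measure_mono (Set.subset_univ U)).trans h1)
  rw [one_div, Real.log_inv] at hκ
  have hlog : Real.log (μ U).toReal ≤ 0 := Real.log_nonpos hp0.le hp1
  rcases Nat.eq_zero_or_pos k with hk0 | hkpos
  · have : (0 : ℝ) < κ := by linarith
    have : 0 < κ := by exact_mod_cast this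
    omega
  have hkR : (0 : ℝ) < k := by exact_mod_cast hkpos
  let f : (Fin d → ℝ) → ℝ := fun x => ∑ i ∈ S, ((W *ᵥ x) i - b i) ^ 2
  have hfint : Integrable f ν := integrable_finsetSum _ fun i _ => hsqint i
  have hfI : ∫ x, f x ∂ν ≤ k / (30000 * d) := by
    simp only [f]
    rw [integral_finsetSum _ fun i _ => hsqint i]
    calc _ ≤ ∑ i ∈ S, 1 / (30000 * (d : ℝ)) := by
          refine Finset.sum_le_sum fun i hi => ?_
          rw [← heig]
          exact (not_le.1 (Finset.mem_filter.1 hi).2).le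
      _ = _ := by rw [Finset.sum_const, nsmul_eq_mul, ← hk]; ring
  have hfm : Measurable f := by
    simp only [f, hw]; fun_prop
  set A := {x | f x ≤ (k : ℝ) / (15000 * d)} with hAset
  have hAm : MeasurableSet A := measurableSet_le hfm measurable_const
  have hmk := mul_meas_ge_le_integral_of_nonneg (μ := ν) (f := f)
    (Filter.Eventually.of_forall fun x => Finset.sum_nonneg fun i _ => sq_nonneg _) hfint
    ((k : ℝ) / (15000 * d))
  have hε : 0 < (k : ℝ) / (15000 * d) := by positivity
  have hmk2 : ν.real {x | (k : ℝ) / (15000 * d) ≤ f x} ≤ 1 / 2 := by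
    have : (k : ℝ) / (15000 * d) * ν.real {x | (k : ℝ) / (15000 * d) ≤ f x}
        ≤ (k : ℝ) / (15000 * d) * (1 / 2) := by
      refine (hmk.trans hfI).trans (le_of_eq ?_)
      field_simp; norm_num
    exact le_of_mul_le_mul_left this hε
  have hνA : 1 / 2 ≤ ν.real A := by
    have h2 : ν.real Aᶜ ≤ ν.real {x | (k : ℝ) / (15000 * d) ≤ f x} := by
      refine measureReal_mono ?_ (measure_ne_top _ _)
      intro x hx
      have hx' : ¬ (f x ≤ (k : ℝ) / (15000 * d)) := hx
      exact (not_le.1 hx').le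
    rw [probReal_compl_eq_one_sub hAm] at h2
    linarith
  have hνA2 : ν.real A ≤ (μ U).toReal⁻¹ * Real.exp (-(k : ℝ)) := by
    rw [hν, measureReal_def, cond_apply hU, ENNReal.toReal_mul, ENNReal.toReal_inv]
    refine mul_le_mul_of_nonneg_left ?_ (by positivity)
    · refine (measureReal_mono Set.inter_subset_right).trans ?_
      exact ENNReal.toReal_le_of_le_ofReal (Real.exp_pos _).le (hsb W hW S b)
  have h6 : (μ U).toReal ≤ 2 * Real.exp (-(k : ℝ)) := by
    have := hνA.trans hνA2
    rw [inv_mul_eq_div, le_div_iff₀ hp0] at this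
    linarith
  have h7 : Real.log (μ U).toReal ≤ Real.log 2 - k := by
    have := Real.log_le_log hp0 h6
    rw [Real.log_mul (by norm_num) (Real.exp_pos _).ne', Real.log_exp] at this
    linarith
  have h8 : Real.log 2 < 1 := by have := Real.log_two_lt_d9; linarith
  have : (k : ℝ) < κ := by linarith
  exact_mod_cast this

/-- Large-measure sets have high-rank covariance: there is a universal constant `C > 0` such
that if `μ` is `N(0, I_d/d)` or `Unif[B_d]` and `μ(U) > 0`, then for any natural number
`κ ≥ C(1 + log(1/μ(U)))`, the `(d−κ+1)`-th largest eigenvalue of `Σ_U` is at least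
`1/(30000 d)`; equivalently, at least `d+1−κ` of the eigenvalues of `Σ_U` (with multiplicity)
are `≥ 1/(30000 d)`. -/
theorem cov_of_large_measure_set_high_rank :
    ∃ C : ℝ, 0 < C ∧
      ∀ (d : ℕ) (μ : Measure (Fin d → ℝ)),
        (μ = stdGaussianScaled d ∨ μ = uniformBall d) →
        ∀ U : Set (Fin d → ℝ), MeasurableSet U → 0 < μ U →
          ∀ κ : ℕ, (κ : ℝ) ≥ C * (1 + Real.log (1 / (μ U).toReal)) →
            d + 1 - κ ≤
              Nat.card {i : Fin d //
                1 / (30000 * (d : ℝ)) ≤ (covMatrix_isHermitian μ U).eigenvalues i} := by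
  refine ⟨1, one_pos, ?_⟩
  intro d μ hμ U hU hμU κ hκ
  rcases Nat.eq_zero_or_pos d with rfl | hd
  · have h1 : μ U ≤ 1 := by
      rcases hμ with rfl | rfl
      · haveI : IsProbabilityMeasure (stdGaussianScaled 0) := by
          unfold stdGaussianScaled; infer_instance
        exact prob_le_one
      · exact (measure_mono (Set.subset_univ U)).trans (aux_ball_univ 0)
    have h2 : 0 ≤ Real.log (1 / (μ U).toReal) := by
      apply Real.log_nonneg
      rw [le_div_iff₀ (ENNReal.toReal_pos hμU.ne' (h1.trans_lt ENNReal.one_lt_top).ne), one_mul]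
      exact ENNReal.toReal_le_of_le_ofReal zero_le_one (by simpa using h1)
    have h3 : (1 : ℝ) ≤ κ := by linarith
    have h4 : 1 ≤ κ := by exact_mod_cast h3
    omega
  · have h1 : μ Set.univ ≤ 1 := by
      rcases hμ with rfl | rfl
      · haveI : IsProbabilityMeasure (stdGaussianScaled d) := by
          unfold stdGaussianScaled; infer_instance
        exact prob_le_one
      · exact aux_ball_univ d
    refine aux_core d hd μ h1 ?_ ?_ U hU hμU κ hκ
    · intro i
      rcases hμ with rfl | rfl
      · exact aux_gauss_memLp d i
      · exact aux_ball_memLp d i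
    · intro W hW S b
      rcases hμ with rfl | rfl
      · have hu := h1
        rw [aux_pi_gauss d hd] at hu ⊢
        exact aux_smallball d hd _ (by fun_prop) (by simpa using hu) W hW (aux_gauss_dec d hd) S b
      · have hu := h1
        rw [aux_ball_density d] at hu ⊢
        exact aux_smallball d hd _ (Measurable.indicator (by fun_prop) (aux_ball_meas d))
          (by simpa using hu) W hW (aux_ball_dec d) S b

end
end

section
/- There exist universal constants C, c > 0 such that the following holds. Let A and B be random d × w matrices with i.i.d. standard Gaussian N(0,1) entries, independent of each other. Then P[ |‖A B^⊤‖_F² − d²·w| > d²·w/5 ] ≤ C·exp(−c·min(d, w)). -/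
open MeasureTheory ProbabilityTheory Matrix
open scoped ENNReal NNReal

noncomputable section

/-- Squared Frobenius norm of a matrix. -/
def frobSq {a b : ℕ} (M : Matrix (Fin a) (Fin b) ℝ) : ℝ := ∑ i, ∑ j, (M i j) ^ 2

/-- The law of a `d × w` matrix with i.i.d. standard Gaussian `N(0,1)` entries (encoded as a
function `Fin d → Fin w → ℝ`). -/
def gaussEntries (d w : ℕ) : Measure (Fin d → Fin w → ℝ) :=
  Measure.pi fun _ => Measure.pi fun _ => gaussianReal 0 1

lemma gp_lin_law {w : ℕ} (v : Fin w → ℝ) (hv : ∑ l, v l ^ 2 = 1) :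
    (Measure.pi fun _ : Fin w => gaussianReal 0 1).map (fun x => ∑ l, v l * x l)
      = gaussianReal 0 1 := by
  have hm : Measurable (fun x : Fin w → ℝ => ∑ l, v l * x l) := by fun_prop
  have : IsProbabilityMeasure ((Measure.pi fun _ : Fin w => gaussianReal 0 1).map
      (fun x => ∑ l, v l * x l)) := Measure.isProbabilityMeasure_map hm.aemeasurable
  refine Measure.ext_of_charFun (funext fun t => ?_)
  rw [charFun_apply_real, integral_map hm.aemeasurable (by fun_prop)]
  have h1 : ∀ x : Fin w → ℝ, Complex.exp (t * ((∑ l, v l * x l : ℝ) : ℂ) * Complex.I)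
      = ∏ l, Complex.exp (((t * v l : ℝ) : ℂ) * (x l : ℂ) * Complex.I) := by
    intro x
    rw [← Complex.exp_sum]
    congr 1
    push_cast
    rw [Finset.mul_sum, Finset.sum_mul]
    exact Finset.sum_congr rfl fun l _ => by ring
  simp_rw [h1]
  rw [integral_fintype_prod_eq_prod
    (f := fun l (y : ℝ) => Complex.exp (((t * v l : ℝ) : ℂ) * (y : ℂ) * Complex.I))]
  simp_rw [← charFun_apply_real, charFun_gaussianReal]
  rw [← Complex.exp_sum]
  congr 1
  have h2 : (∑ l, ((v l : ℂ)) ^ 2) = 1 := by exact_mod_cast hv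
  simp only [NNReal.coe_one, Complex.ofReal_zero, mul_zero, zero_mul, zero_sub, Complex.ofReal_one, one_mul, Complex.ofReal_mul, mul_pow]
  rw [Finset.sum_neg_distrib, ← Finset.sum_div, ← Finset.mul_sum, h2, mul_one]

lemma gp_gauss_sq (u : ℝ) (hu : u < 1 / 2) :
    ∫⁻ x, ENNReal.ofReal (Real.exp (u * x ^ 2)) ∂(gaussianReal 0 1)
      = ENNReal.ofReal ((√(1 - 2 * u))⁻¹) := by
  rw [gaussianReal_of_var_ne_zero 0 one_ne_zero,
    lintegral_withDensity_eq_lintegral_mul _ (by fun_prop) (by fun_prop)]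
  have h1 : ∀ x : ℝ, (gaussianPDF 0 1 * fun x => ENNReal.ofReal (Real.exp (u * x ^ 2))) x
      = ENNReal.ofReal ((√(2 * Real.pi))⁻¹ * Real.exp (-(1 / 2 - u) * x ^ 2)) := by
    intro x
    simp only [Pi.mul_apply, gaussianPDF, gaussianPDFReal]
    rw [← ENNReal.ofReal_mul (by positivity)]
    congr 1
    simp only [NNReal.coe_one, mul_one, sub_zero]
    rw [mul_assoc, ← Real.exp_add]
    congr 2
    ring
  simp_rw [h1]
  rw [← ofReal_integral_eq_lintegral_ofReal, integral_const_mul, integral_gaussian]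
  · congr 1
    rw [← Real.sqrt_inv, ← Real.sqrt_inv, ← Real.sqrt_mul (by positivity)]
    congr 1
    have : 1 - 2 * u ≠ 0 := by linarith
    have : 1 / 2 - u ≠ 0 := by linarith
    field_simp
  · exact (integrable_exp_neg_mul_sq (by linarith)).const_mul _
  · exact Filter.Eventually.of_forall fun x => by positivity

lemma gp_const_pos : Real.exp (-(1 / 40) * (13 / 12)) * (√(1 - 2 * (1 / 40)))⁻¹ < 1 := by
  rw [← div_eq_mul_inv, div_lt_one (by apply Real.sqrt_pos.2; norm_num)]
  apply Real.lt_sqrt_of_sq_lt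
  rw [← Real.exp_nat_mul]
  have := Real.abs_exp_sub_one_sub_id_le (x := ((2:ℕ):ℝ) * (-(1 / 40) * (13 / 12))) (by norm_num [abs_le])
  rw [abs_le] at this
  norm_num at this ⊢
  linarith [this.2]

lemma gp_const_neg : Real.exp ((1 / 40) * (11 / 12)) * (√(1 - 2 * (-(1 / 40))))⁻¹ < 1 := by
  rw [← div_eq_mul_inv, div_lt_one (by apply Real.sqrt_pos.2; norm_num)]
  apply Real.lt_sqrt_of_sq_lt
  rw [← Real.exp_nat_mul]
  have := Real.abs_exp_sub_one_sub_id_le (x := ((2:ℕ):ℝ) * ((1 / 40) * (11 / 12))) (by norm_num [abs_le])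
  rw [abs_le] at this
  norm_num at this ⊢
  linarith [this.2]

lemma gp_const : ∃ c : ℝ, 0 < c ∧
    Real.exp (-(1 / 40) * (13 / 12)) * (√(1 - 2 * (1 / 40)))⁻¹ ≤ Real.exp (-c) ∧
    Real.exp ((1 / 40) * (11 / 12)) * (√(1 - 2 * (-(1 / 40))))⁻¹ ≤ Real.exp (-c) := by
  set r := max (Real.exp (-(1 / 40) * (13 / 12)) * (√(1 - 2 * (1 / 40)))⁻¹)
    (Real.exp ((1 / 40) * (11 / 12)) * (√(1 - 2 * (-(1 / 40))))⁻¹) with hr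
  have h1 : r < 1 := max_lt gp_const_pos gp_const_neg
  have h0 : 0 < r := by
    apply lt_max_of_lt_left
    have : 0 < √(1 - 2 * (1 / 40) : ℝ) := by apply Real.sqrt_pos.2; norm_num
    positivity
  refine ⟨-Real.log r, by linarith [Real.log_neg h0 h1], ?_, ?_⟩ <;>
    rw [neg_neg, Real.exp_log h0]
  · exact le_max_left _ _
  · exact le_max_right _ _

/-- Jensen bound on the Laplace transform of a normalized quadratic form. -/
lemma gp_mgf {k w : ℕ} (M : Fin k → Fin w → ℝ) (T : ℝ) (hT : T = ∑ i, ∑ l, M i l ^ 2)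
    (h0 : 0 < T) (u : ℝ) (hu : u < 1 / 2) :
    ∫⁻ b, ENNReal.ofReal (Real.exp (u * ((∑ i, (∑ l, M i l * b l) ^ 2) / T)))
        ∂(Measure.pi fun _ : Fin w => gaussianReal 0 1)
      ≤ ENNReal.ofReal ((√(1 - 2 * u))⁻¹) := by
  set s : Fin k → ℝ := fun i => ∑ l, M i l ^ 2 with hs
  have hs0 : ∀ i, 0 ≤ s i := fun i => Finset.sum_nonneg fun l _ => sq_nonneg _
  have hsum : ∑ i, s i / T = 1 := by
    rw [← Finset.sum_div, ← hT, div_self h0.ne']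
  have hz : ∀ i, s i = 0 → ∀ l, M i l = 0 := by
    intro i hi l
    have := (Finset.sum_eq_zero_iff_of_nonneg (fun l _ => sq_nonneg (M i l))).1 hi l (Finset.mem_univ _)
    exact pow_eq_zero_iff two_ne_zero |>.1 this
  have hpt : ∀ b : Fin w → ℝ,
      ENNReal.ofReal (Real.exp (u * ((∑ i, (∑ l, M i l * b l) ^ 2) / T)))
      ≤ ∑ i, ENNReal.ofReal (s i / T) *
        ENNReal.ofReal (Real.exp (u * (∑ l, (M i l / √(s i)) * b l) ^ 2)) := by
    intro b
    have hj := convexOn_exp.map_sum_le (t := Finset.univ) (w := fun i => s i / T)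
      (p := fun i => u * (∑ l, (M i l / √(s i)) * b l) ^ 2)
      (fun i _ => div_nonneg (hs0 i) h0.le) hsum (fun i _ => Set.mem_univ _)
    have he : ∑ i, (s i / T) • (u * (∑ l, (M i l / √(s i)) * b l) ^ 2)
        = u * ((∑ i, (∑ l, M i l * b l) ^ 2) / T) := by
      rw [Finset.sum_div, Finset.mul_sum]
      refine Finset.sum_congr rfl fun i _ => ?_
      by_cases hi : s i = 0
      · simp [hi, hz i hi]
      · have : ∑ l, (M i l / √(s i)) * b l = (∑ l, M i l * b l) / √(s i) := by
          rw [Finset.sum_div]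
          exact Finset.sum_congr rfl fun l _ => by ring
        rw [this, div_pow, Real.sq_sqrt (hs0 i), smul_eq_mul]
        field_simp
    rw [he] at hj
    refine (ENNReal.ofReal_le_ofReal hj).trans ?_
    rw [ENNReal.ofReal_sum_of_nonneg]
    · refine Finset.sum_le_sum fun i _ => ?_
      rw [smul_eq_mul, ENNReal.ofReal_mul (div_nonneg (hs0 i) h0.le)]
    · intro i _
      exact mul_nonneg (div_nonneg (hs0 i) h0.le) (Real.exp_pos _).le
  refine (lintegral_mono hpt).trans ?_
  rw [lintegral_finsetSum _ (by intro i _; fun_prop)]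
  have hterm : ∀ i, ∫⁻ b, ENNReal.ofReal (s i / T) *
        ENNReal.ofReal (Real.exp (u * (∑ l, (M i l / √(s i)) * b l) ^ 2))
        ∂(Measure.pi fun _ : Fin w => gaussianReal 0 1)
      = ENNReal.ofReal (s i / T) * ENNReal.ofReal ((√(1 - 2 * u))⁻¹) := by
    intro i
    by_cases hi : s i = 0
    · simp [hi]
    · have h1 : ∑ l, (M i l / √(s i)) ^ 2 = 1 := by
        simp_rw [div_pow, Real.sq_sqrt (hs0 i)]
        rw [← Finset.sum_div]
        exact div_self hi
      have h2 := gp_gauss_sq u hu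
      rw [← gp_lin_law (fun l => M i l / √(s i)) h1,
        lintegral_map (by fun_prop) (by fun_prop)] at h2
      rw [lintegral_const_mul _ (by fun_prop), h2]
  simp_rw [hterm]
  rw [← Finset.sum_mul, ← ENNReal.ofReal_sum_of_nonneg
    (fun i _ => div_nonneg (hs0 i) h0.le), hsum, ENNReal.ofReal_one, one_mul]

lemma gp_chernoff {E : Type*} [MeasurableSpace E] (μ : Measure E) [IsProbabilityMeasure μ]
    (n : ℕ) (f : E → ℝ) (hf : Measurable f) (u a c : ℝ)
    (h : ∫⁻ x, ENNReal.ofReal (Real.exp (u * f x)) ∂μ ≤ ENNReal.ofReal (Real.exp (u * a - c))) :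
    (Measure.pi fun _ : Fin n => μ) {x | u * (a * n) ≤ u * ∑ j, f (x j)} ≤
      ENNReal.ofReal (Real.exp (-c * n)) := by
  have hg : Measurable (fun x : E => ENNReal.ofReal (Real.exp (u * f x - u * a))) := by fun_prop
  have h1 : ∫⁻ x, ENNReal.ofReal (Real.exp (u * f x - u * a)) ∂μ ≤ ENNReal.ofReal (Real.exp (-c)) := by
    have : ∀ x, ENNReal.ofReal (Real.exp (u * f x - u * a))
        = ENNReal.ofReal (Real.exp (-(u * a))) * ENNReal.ofReal (Real.exp (u * f x)) := by
      intro x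
      rw [← ENNReal.ofReal_mul (Real.exp_pos _).le, ← Real.exp_add]
      congr 2; ring
    simp_rw [this]
    rw [lintegral_const_mul _ (by fun_prop)]
    refine (mul_le_mul_right h _).trans ?_
    rw [← ENNReal.ofReal_mul (Real.exp_pos _).le, ← Real.exp_add]
    apply le_of_eq; congr 2; ring
  have hind : iIndepFun (fun (i : Fin n) (x : Fin n → E) => x i) (Measure.pi fun _ : Fin n => μ) :=
    iIndepFun_pi (X := fun _ => id) (fun i => aemeasurable_id)
  have h2 : ∫⁻ x, ∏ j, ENNReal.ofReal (Real.exp (u * f (x j) - u * a)) ∂(Measure.pi fun _ : Fin n => μ)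
      ≤ ENNReal.ofReal (Real.exp (-c * n)) := by
    rw [lintegral_prod_eq_prod_lintegral_of_indepFun Finset.univ
      (fun j (x : Fin n → E) => ENNReal.ofReal (Real.exp (u * f (x j) - u * a)))
      (hind.comp (fun _ => fun x : E => ENNReal.ofReal (Real.exp (u * f x - u * a))) (fun _ => hg))
      (fun j => by fun_prop)]
    have : ∀ j : Fin n, ∫⁻ x : Fin n → E, ENNReal.ofReal (Real.exp (u * f (x j) - u * a))
        ∂(Measure.pi fun _ : Fin n => μ) ≤ ENNReal.ofReal (Real.exp (-c)) := by
      intro j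
      rw [(measurePreserving_eval (fun _ : Fin n => μ) j).lintegral_comp hg]
      exact h1
    refine (Finset.prod_le_prod' fun j _ => this j).trans ?_
    rw [Finset.prod_const, ← ENNReal.ofReal_pow (Real.exp_pos _).le, ← Real.exp_nat_mul]
    simp [mul_comm]
  refine le_trans ?_ h2
  have hpm : Measurable (fun x : Fin n → E =>
      ∏ j, ENNReal.ofReal (Real.exp (u * f (x j) - u * a))) := by fun_prop
  refine le_trans (measure_mono ?_) ((one_mul _).symm.trans_le (mul_meas_ge_le_lintegral₀ (μ := Measure.pi fun _ : Fin n => μ)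
    (f := fun x => ∏ j, ENNReal.ofReal (Real.exp (u * f (x j) - u * a))) hpm.aemeasurable 1))
  intro x hx
  simp only [Set.mem_ofPred_eq] at hx ⊢
  rw [← ENNReal.ofReal_prod_of_nonneg (fun _ _ => (Real.exp_pos _).le), ← Real.exp_sum,
    ENNReal.one_le_ofReal, Real.one_le_exp_iff, Finset.sum_sub_distrib, ← Finset.mul_sum]
  simp
  linarith

lemma gp_quad {c : ℝ}
    (hc1 : Real.exp (-(1 / 40) * (13 / 12)) * (√(1 - 2 * (1 / 40)))⁻¹ ≤ Real.exp (-c))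
    (hc2 : Real.exp ((1 / 40) * (11 / 12)) * (√(1 - 2 * (-(1 / 40))))⁻¹ ≤ Real.exp (-c))
    {k w : ℕ} (d : ℕ) (M : Fin k → Fin w → ℝ) (T : ℝ) (hT : T = ∑ i, ∑ l, M i l ^ 2)
    (h0 : 0 < T) :
    gaussEntries d w {B | T * d / 12 < |∑ j, ∑ i, (∑ l, M i l * B j l) ^ 2 - T * d|} ≤
      2 * ENNReal.ofReal (Real.exp (-c * d)) := by
  set f : (Fin w → ℝ) → ℝ := fun b => (∑ i, (∑ l, M i l * b l) ^ 2) / T with hf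
  have hfm : Measurable f := by fun_prop
  have key : ∀ u a : ℝ, u < 1 / 2 → Real.exp (-u * a) * (√(1 - 2 * u))⁻¹ ≤ Real.exp (-c) →
      gaussEntries d w {x | u * (a * d) ≤ u * ∑ j, f (x j)} ≤ ENNReal.ofReal (Real.exp (-c * d)) := by
    intro u a hu hb
    refine gp_chernoff _ d f hfm u a c ((gp_mgf M T hT h0 u hu).trans (ENNReal.ofReal_le_ofReal ?_))
    have : Real.exp (u * a - c) = Real.exp (u * a) * Real.exp (-c) := by
      rw [← Real.exp_add]; congr 1
    rw [this]
    calc _ = Real.exp (u * a) * (Real.exp (-u * a) * (√(1 - 2 * u))⁻¹) := by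
          rw [← mul_assoc, ← Real.exp_add]; simp
      _ ≤ _ := by gcongr
  have k1 := key (1 / 40) (13 / 12) (by norm_num) hc1
  have k2 := key (-(1 / 40)) (11 / 12) (by norm_num) (by simpa using hc2)
  rw [two_mul]
  refine (measure_mono ?_).trans ((measure_union_le _ _).trans (add_le_add k1 k2))
  intro B hB
  simp only [Set.mem_ofPred_eq, Set.mem_union] at hB ⊢
  have : ∑ j, ∑ i, (∑ l, M i l * B j l) ^ 2 = T * ∑ j, f (B j) := by
    simp only [hf]
    rw [← Finset.sum_div]; field_simp
  rw [this] at hB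
  set S := ∑ j, f (B j)
  rcases lt_abs.1 hB with h | h
  · left
    have : T * (d * (13 / 12)) < T * S := by linarith
    have := lt_of_mul_lt_mul_left this h0.le
    linarith
  · right
    have : T * S < T * (d * (11 / 12)) := by linarith
    have := lt_of_mul_lt_mul_left this h0.le
    linarith

/-- Concentration of `‖ABᵀ‖_F²` for independent `d × w` standard Gaussian matrices `A, B`:
there are universal constants `C, c > 0` such that
`P[|‖ABᵀ‖_F² − d²w| > d²w/5] ≤ C exp(−c min(d,w))`. -/
theorem gaussian_product_frobenius_concentration :
    ∃ C c : ℝ, 0 < C ∧ 0 < c ∧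
      ∀ d w : ℕ,
        ((gaussEntries d w).prod (gaussEntries d w))
            {q | (d : ℝ) ^ 2 * w / 5 <
              |frobSq (Matrix.of q.1 * (Matrix.of q.2)ᵀ) - (d : ℝ) ^ 2 * w|} ≤
          ENNReal.ofReal (C * Real.exp (-c * min (d : ℝ) (w : ℝ))) := by
  obtain ⟨c, hc, hc1, hc2⟩ := gp_const
  refine ⟨4, c, by norm_num, hc, fun d w => ?_⟩
  have : IsProbabilityMeasure (gaussEntries d w) := by unfold gaussEntries; infer_instance
  rcases Nat.eq_zero_or_pos d with hd | hd
  · refine prob_le_one.trans ?_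
    rw [ENNReal.one_le_ofReal]
    simp [hd]
  rcases Nat.eq_zero_or_pos w with hw | hw
  · refine prob_le_one.trans ?_
    rw [ENNReal.one_le_ofReal]
    simp [hw]
  have hd' : (0 : ℝ) < d := by exact_mod_cast hd
  have hw' : (0 : ℝ) < w := by exact_mod_cast hw
  have hfrob : ∀ A B : Fin d → Fin w → ℝ, frobSq (Matrix.of A * (Matrix.of B)ᵀ)
      = ∑ j, ∑ i, (∑ l, A i l * B j l) ^ 2 := by
    intro A B
    unfold frobSq
    rw [Finset.sum_comm]
    simp [Matrix.mul_apply]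
  set e := ENNReal.ofReal (Real.exp (-c * d)) with he
  have hA := gp_quad hc1 hc2 d (fun i l : Fin w => if i = l then (1 : ℝ) else 0) w
    (by simp) hw'
  simp only [ite_mul, one_mul, zero_mul, Finset.sum_ite_eq, Finset.mem_univ, if_true] at hA
  set bad : Set (Fin d → Fin w → ℝ) :=
    {A | (w : ℝ) * d / 12 < |∑ j, ∑ i, A j i ^ 2 - w * d|} with hbad
  have hbm : MeasurableSet bad := measurableSet_lt (by fun_prop) (by fun_prop)
  have hms : MeasurableSet {q : (Fin d → Fin w → ℝ) × (Fin d → Fin w → ℝ) | (d : ℝ) ^ 2 * w / 5 <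
              |frobSq (Matrix.of q.1 * (Matrix.of q.2)ᵀ) - (d : ℝ) ^ 2 * w|} := by
    simp_rw [hfrob]
    exact measurableSet_lt (by fun_prop) (by fun_prop)
  rw [Measure.prod_apply hms]
  have hsec : ∀ A, gaussEntries d w (Prod.mk A ⁻¹' {q : (Fin d → Fin w → ℝ) × (Fin d → Fin w → ℝ) |
      (d : ℝ) ^ 2 * w / 5 < |frobSq (Matrix.of q.1 * (Matrix.of q.2)ᵀ) - (d : ℝ) ^ 2 * w|})
      ≤ bad.indicator 1 A + 2 * e := by
    intro A
    by_cases hAb : A ∈ bad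
    · rw [Set.indicator_of_mem hAb]
      exact prob_le_one.trans le_self_add
    · rw [Set.indicator_of_notMem hAb, zero_add]
      simp only [hbad, Set.mem_ofPred_eq, not_lt] at hAb
      set T := ∑ j, ∑ i, A j i ^ 2 with hT
      obtain ⟨h1, h2⟩ := abs_le.1 hAb
      have hwd : 0 < (w : ℝ) * d := by positivity
      refine (measure_mono ?_).trans (gp_quad hc1 hc2 d A T hT (by linarith))
      intro B hB
      simp only [Set.mem_preimage, Set.mem_ofPred_eq, hfrob] at hB ⊢
      set S := ∑ j, ∑ i, (∑ l, A i l * B j l) ^ 2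
      have h1' : (w : ℝ) * d * (11 / 12) * d ≤ T * d := by gcongr; linarith
      have h2' : T * d ≤ (w : ℝ) * d * (13 / 12) * d := by gcongr; linarith
      have hp : 0 < (w : ℝ) * d * d := by positivity
      rcases lt_abs.1 hB with h | h
      · exact lt_abs.2 (Or.inl (by nlinarith))
      · exact lt_abs.2 (Or.inr (by nlinarith))
  refine (lintegral_mono hsec).trans ?_
  rw [lintegral_add_right _ (by fun_prop), lintegral_indicator_one hbm, lintegral_const, measure_univ, mul_one]
  refine (add_le_add_left hA _).trans ?_
  rw [← add_mul, ENNReal.ofReal_mul (by norm_num)]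
  have h4 : (2 + 2 : ℝ≥0∞) = ENNReal.ofReal 4 := by norm_num
  rw [h4]
  refine mul_le_mul_right ?_ _
  exact ENNReal.ofReal_le_ofReal (Real.exp_le_exp.2 (by nlinarith [min_le_left (d:ℝ) w]))

end
end

section
/- There exist universal constants C, c > 0 such that the following holds. Let A and B be independent random d × w matrices with i.i.d. standard Gaussian N(0,1) entries. Then for any integer k ≤ c·d²·w / max(d,w)², P[ min over matrices U of rank at most k of ‖A B^⊤ − U‖_F² < d²·w/2 ] ≤ C·exp(−c·min(d, w)). -/
open MeasureTheory ProbabilityTheory Matrix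
open scoped ENNReal NNReal

noncomputable section

instance gaussEntries_prob (d w : ℕ) : IsProbabilityMeasure (gaussEntries d w) := by
  unfold gaussEntries; infer_instance

/-- Gaussian integral of `exp (θ x²)`. -/
lemma lint_gauss (θ : ℝ) (h : θ < 1 / 2) :
    ∫⁻ x, ENNReal.ofReal (Real.exp (θ * x ^ 2)) ∂(gaussianReal 0 1)
      = ENNReal.ofReal (√(1 - 2 * θ))⁻¹ := by
  rw [gaussianReal_of_var_ne_zero _ one_ne_zero,
    lintegral_withDensity_eq_lintegral_mul _ (measurable_gaussianPDF 0 1) (by fun_prop)]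
  have e : ∀ x : ℝ, (gaussianPDF 0 1 * fun x => ENNReal.ofReal (Real.exp (θ * x ^ 2))) x
      = ENNReal.ofReal ((√(2 * Real.pi))⁻¹ * Real.exp (-(1 / 2 - θ) * x ^ 2)) := by
    intro x
    simp only [Pi.mul_apply, gaussianPDF, gaussianPDFReal]
    rw [← ENNReal.ofReal_mul (by positivity), mul_assoc, ← Real.exp_add]
    congr 3
    · simp
    · simp; ring
  simp_rw [e]
  have hi : Integrable (fun x : ℝ => (√(2 * Real.pi))⁻¹ * Real.exp (-(1 / 2 - θ) * x ^ 2)) :=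
    (integrable_exp_neg_mul_sq (by linarith)).const_mul _
  rw [← ofReal_integral_eq_lintegral_ofReal hi (ae_of_all _ fun x => by positivity),
    integral_const_mul, integral_gaussian]
  congr 1
  rw [← Real.sqrt_inv, ← Real.sqrt_mul (by positivity), ← Real.sqrt_inv]
  congr 1
  have : (1 / 2 - θ) ≠ 0 := by linarith
  have : (1 - 2 * θ) ≠ 0 := by linarith
  have := Real.pi_ne_zero
  field_simp

lemma map_lin {w : ℕ} (u : Fin w → ℝ) :
    (Measure.pi fun _ : Fin w => gaussianReal 0 1).map (fun a => ∑ j, a j * u j)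
      = (gaussianReal 0 1).map (fun x => √(∑ j, u j ^ 2) * x) := by
  have h := (inferInstance : IsGaussian (stdGaussian (EuclideanSpace ℝ (Fin w))))
  have h1 := h.map_eq_gaussianReal (innerSL ℝ (WithLp.toLp 2 u))
  rw [integral_strongDual_stdGaussian, variance_dual_stdGaussian, ← map_pi_eq_stdGaussian,
    Measure.map_map (by fun_prop) (by fun_prop), innerSL_apply_norm, EuclideanSpace.real_norm_sq_eq] at h1
  rw [gaussianReal_map_const_mul]
  convert h1 using 2
  · funext a
    simp [PiLp.inner_apply]
  · simp
  · ext
    simp [Real.sq_sqrt (Finset.sum_nonneg fun i _ => sq_nonneg (u i)),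
      Finset.sum_nonneg fun i _ => sq_nonneg (u i)]

lemma lint_lin {w : ℕ} (u : Fin w → ℝ) (s : ℝ) (h : s * ∑ j, u j ^ 2 < 1 / 2) :
    ∫⁻ a, ENNReal.ofReal (Real.exp (s * (∑ j, a j * u j) ^ 2))
        ∂(Measure.pi fun _ : Fin w => gaussianReal 0 1)
      = ENNReal.ofReal (√(1 - 2 * (s * ∑ j, u j ^ 2)))⁻¹ := by
  rw [← lint_gauss _ h]
  have := lintegral_map (μ := Measure.pi fun _ : Fin w => gaussianReal 0 1)
    (f := fun x => ENNReal.ofReal (Real.exp (s * x ^ 2))) (g := fun a => ∑ j, a j * u j)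
    (by fun_prop) (by fun_prop)
  rw [← this, map_lin, lintegral_map (by fun_prop) (by fun_prop)]
  congr 1; ext x
  rw [mul_pow, Real.sq_sqrt (Finset.sum_nonneg fun i _ => sq_nonneg (u i)), mul_assoc]

lemma lint_pi {X : Type*} [MeasurableSpace X] (μ : Measure X) [IsProbabilityMeasure μ] (d : ℕ)
    (f : X → ℝ) (hf : Measurable f) (β : ℝ)
    (h : ∫⁻ x, ENNReal.ofReal (Real.exp (f x)) ∂μ ≤ ENNReal.ofReal (Real.exp β)) :
    ∫⁻ x, ENNReal.ofReal (Real.exp (∑ i, f (x i))) ∂(Measure.pi fun _ : Fin d => μ)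
      ≤ ENNReal.ofReal (Real.exp (d * β)) := by
  have hm : Measurable fun x => ENNReal.ofReal (Real.exp (f x)) := by fun_prop
  have e : ∀ x : Fin d → X, ENNReal.ofReal (Real.exp (∑ i, f (x i)))
      = ∏ i, (fun x : Fin d → X => ENNReal.ofReal (Real.exp (f (x i)))) x := by
    intro x
    rw [Real.exp_sum, ENNReal.ofReal_prod_of_nonneg fun i _ => (Real.exp_pos _).le]
  simp_rw [e]
  have := lintegral_prod_eq_prod_lintegral_of_indepFun (μ := Measure.pi fun _ : Fin d => μ)
    Finset.univ (fun i (x : Fin d → X) => ENNReal.ofReal (Real.exp (f (x i))))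
    (iIndepFun_pi (X := fun _ x => ENNReal.ofReal (Real.exp (f x))) fun i => hm.aemeasurable)
    (fun i => by fun_prop)
  rw [this]
  have e2 : ∀ i : Fin d, ∫⁻ x : Fin d → X, ENNReal.ofReal (Real.exp (f (x i)))
      ∂(Measure.pi fun _ : Fin d => μ) ≤ ENNReal.ofReal (Real.exp β) := by
    intro i
    refine le_trans (le_of_eq ?_) h
    exact (measurePreserving_eval (fun _ : Fin d => μ) i).lintegral_comp hm
  calc _ ≤ ∏ i : Fin d, ENNReal.ofReal (Real.exp β) := Finset.prod_le_prod' fun i _ => e2 i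
    _ = _ := by
      rw [Finset.prod_const, ← ENNReal.ofReal_pow (Real.exp_pos _).le, ← Real.exp_nat_mul]; simp

/-- Chernoff bound. -/
lemma chernoff {X : Type*} [MeasurableSpace X] (μ : Measure X) (f : X → ℝ) (hf : Measurable f)
    (a β : ℝ) (h : ∫⁻ x, ENNReal.ofReal (Real.exp (f x)) ∂μ ≤ ENNReal.ofReal (Real.exp β)) :
    μ {x | a ≤ f x} ≤ ENNReal.ofReal (Real.exp (β - a)) := by
  have h1 := (mul_meas_ge_le_lintegral (μ := μ) (f := fun x => ENNReal.ofReal (Real.exp (f x)))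
    (by fun_prop) (ENNReal.ofReal (Real.exp a))).trans h
  have h2 : {x | a ≤ f x} = {x | ENNReal.ofReal (Real.exp a) ≤ ENNReal.ofReal (Real.exp (f x))} := by
    ext x
    simp [ENNReal.ofReal_le_ofReal_iff (Real.exp_pos _).le]
  rw [h2, Real.exp_sub, ENNReal.ofReal_div_of_pos (Real.exp_pos _),
    ENNReal.le_div_iff_mul_le (Or.inl (by simp [Real.exp_pos])) (Or.inl (by simp)), mul_comm]
  exact h1

lemma num1 : (√(1 - 2 * (-(1 / 8 : ℝ))))⁻¹ ≤ Real.exp (-0.11) := by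
  rw [Real.exp_neg]
  apply inv_anti₀ (Real.exp_pos _)
  apply Real.le_sqrt_of_sq_le
  rw [← Real.exp_nat_mul]
  have := Real.exp_bound' (x := 0.22) (by norm_num) (by norm_num) (n := 4) (by norm_num)
  norm_num [Finset.sum_range_succ, Nat.factorial] at this ⊢
  linarith

lemma num2 {θ : ℝ} (h : θ ≤ 1 / 4) : (√(1 - 2 * θ))⁻¹ ≤ Real.exp (1 / 2) := by
  have h1 : √(1 / 2) ≤ √(1 - 2 * θ) := Real.sqrt_le_sqrt (by linarith)
  have h0 : 0 < √(1 / 2 : ℝ) := by positivity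
  refine (inv_anti₀ h0 h1).trans ?_
  rw [← Real.sqrt_inv]
  apply Real.sqrt_le_iff.2 ⟨(Real.exp_pos _).le, ?_⟩
  rw [← Real.exp_nat_mul]
  have := Real.exp_one_gt_d9
  norm_num
  linarith

/-- `E3`: lower tail of the Frobenius norm. -/
lemma tailF (d w : ℕ) : gaussEntries d w {A | ∑ i, ∑ j, A i j ^ 2 < 0.8 * (d * w)}
    ≤ ENNReal.ofReal (Real.exp (-0.01 * (d * w))) := by
  have h0 : ∫⁻ x, ENNReal.ofReal (Real.exp (-(1 / 8) * x ^ 2)) ∂(gaussianReal 0 1)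
      ≤ ENNReal.ofReal (Real.exp (-0.11)) := by
    rw [lint_gauss _ (by norm_num)]
    exact ENNReal.ofReal_le_ofReal num1
  have h1 := lint_pi _ w (fun x => -(1 / 8) * x ^ 2) (by fun_prop) _ h0
  have h2 := lint_pi _ d (fun y : Fin w → ℝ => ∑ j, -(1 / 8) * y j ^ 2) (by fun_prop) _ h1
  have h3 := chernoff _ _ (by fun_prop) (-0.1 * (d * w)) _ h2
  refine (measure_mono ?_).trans (h3.trans (le_of_eq ?_))
  · intro A hA
    simp only [Set.mem_ofPred_eq, ← Finset.mul_sum] at hA ⊢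
    linarith
  · congr 2; ring

/-- `E4`. -/
lemma tailX (d w : ℕ) (A : Fin d → Fin w → ℝ) :
    gaussEntries d w {B | ∑ i, ∑ j, (∑ l, B j l * A i l) ^ 2 < 0.8 * d * ∑ i, ∑ j, A i j ^ 2}
    ≤ ENNReal.ofReal (Real.exp (-0.01 * d)) := by
  set T := ∑ i, ∑ j, A i j ^ 2 with hT
  have hn : ∀ i, 0 ≤ ∑ j, A i j ^ 2 := fun i => Finset.sum_nonneg fun j _ => sq_nonneg _
  have hT0 : 0 ≤ T := Finset.sum_nonneg fun i _ => hn i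
  rcases hT0.eq_or_lt with hT0 | hT0
  · rw [← hT0]
    have : {B : Fin d → Fin w → ℝ | ∑ i, ∑ j, (∑ l, B j l * A i l) ^ 2 < 0.8 * d * 0} = ∅ := by
      ext B
      simp only [Set.mem_ofPred_eq, mul_zero, Set.mem_empty_iff_false, iff_false, not_lt]
      positivity
    rw [this]; simp
  set p : Fin d → ℝ := fun i => (∑ j, A i j ^ 2) / T with hp
  have hp0 : ∀ i, 0 ≤ p i := fun i => div_nonneg (hn i) hT0.le
  have hp1 : ∑ i, p i = 1 := by
    rw [hp, ← Finset.sum_div]; exact div_self hT0.ne'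
  set s : Fin d → ℝ := fun i => -(1 / 8) / (∑ j, A i j ^ 2)
  have h0 : ∫⁻ b, ENNReal.ofReal (Real.exp (-(1 / 8) / T * ∑ i, (∑ l, b l * A i l) ^ 2))
      ∂(Measure.pi fun _ : Fin w => gaussianReal 0 1) ≤ ENNReal.ofReal (Real.exp (-0.11)) := by
    calc _ ≤ ∫⁻ b, ∑ i, ENNReal.ofReal (p i) *
            ENNReal.ofReal (Real.exp (s i * (∑ l, b l * A i l) ^ 2))
          ∂(Measure.pi fun _ : Fin w => gaussianReal 0 1) := by
          apply lintegral_mono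
          intro b
          simp only
          simp_rw [← ENNReal.ofReal_mul (hp0 _)]
          rw [← ENNReal.ofReal_sum_of_nonneg fun i _ => mul_nonneg (hp0 i) (Real.exp_pos _).le]
          apply ENNReal.ofReal_le_ofReal
          have hj := convexOn_exp.map_sum_le (t := Finset.univ) (w := p)
            (p := fun i => s i * (∑ l, b l * A i l) ^ 2) (fun i _ => hp0 i) hp1 (fun _ _ => trivial)
          simp only [smul_eq_mul] at hj
          refine le_trans (le_of_eq ?_) hj
          congr 1
          rw [Finset.mul_sum]
          refine Finset.sum_congr rfl fun i _ => ?_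
          rcases (hn i).eq_or_lt with h | h
          · have : ∀ j, A i j = 0 := by
              intro j
              have := (Finset.sum_eq_zero_iff_of_nonneg fun j _ => sq_nonneg (A i j)).1 h.symm j
                (Finset.mem_univ j)
              exact pow_eq_zero_iff (two_ne_zero) |>.1 this
            simp [this]
          · simp only [p, s]
            have := h.ne'
            field_simp
      _ = ∑ i, ENNReal.ofReal (p i) * ∫⁻ b, 
            ENNReal.ofReal (Real.exp (s i * (∑ l, b l * A i l) ^ 2))
          ∂(Measure.pi fun _ : Fin w => gaussianReal 0 1) := by
          rw [lintegral_finsetSum _ fun i _ => by fun_prop]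
          refine Finset.sum_congr rfl fun i _ => ?_
          rw [lintegral_const_mul _ (by fun_prop)]
      _ ≤ ∑ i, ENNReal.ofReal (p i) * ENNReal.ofReal (Real.exp (-0.11)) := by
          refine Finset.sum_le_sum fun i _ => ?_
          rcases (hn i).eq_or_lt with h | h
          · simp [p, ← h]
          · gcongr
            have e : s i * ∑ j, A i j ^ 2 = -(1 / 8) := div_mul_cancel₀ _ h.ne'
            rw [lint_lin _ _ (by rw [e]; norm_num), e]
            exact ENNReal.ofReal_le_ofReal num1
      _ = _ := by
          rw [← Finset.sum_mul, ← ENNReal.ofReal_sum_of_nonneg fun i _ => hp0 i, hp1]; simp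
  have h2 := lint_pi _ d (fun b : Fin w → ℝ => -(1 / 8) / T * ∑ i, (∑ l, b l * A i l) ^ 2)
    (by fun_prop) _ h0
  have h3 := chernoff _ _ (by fun_prop) (-0.1 * d) _ h2
  refine (measure_mono ?_).trans (h3.trans (le_of_eq ?_))
  · intro B hB
    simp only [Set.mem_ofPred_eq, ← Finset.mul_sum] at hB ⊢
    rw [Finset.sum_comm] at hB
    rw [div_mul_eq_mul_div, le_div_iff₀ hT0]
    linarith
  · congr 2; ring

def qf {d w : ℕ} (A : Fin d → Fin w → ℝ) (u : Fin w → ℝ) : ℝ := ∑ i, (∑ j, A i j * u j) ^ 2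

def eball (w : ℕ) (R : ℝ) : Set (Fin w → ℝ) := {u | ∑ j, u j ^ 2 ≤ R ^ 2}

lemma meas_eball (w : ℕ) (R : ℝ) : MeasurableSet (eball w R) :=
  measurableSet_le (by fun_prop) (by fun_prop)

lemma eball_add {w : ℕ} {x v : Fin w → ℝ} (hx : x ∈ eball w 1) (hv : v ∈ eball w 1) :
    x + v ∈ eball w 2 ∧ x - v ∈ eball w 2 := by
  simp only [eball, Set.mem_ofPred_eq, Pi.add_apply, Pi.sub_apply] at *
  have h : ∑ j, (x j + v j) ^ 2 + ∑ j, (x j - v j) ^ 2 = 2 * ∑ j, x j ^ 2 + 2 * ∑ j, v j ^ 2 := by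
    rw [Finset.mul_sum, Finset.mul_sum, ← Finset.sum_add_distrib, ← Finset.sum_add_distrib]
    exact Finset.sum_congr rfl fun j _ => by ring
  have h1 : 0 ≤ ∑ j, (x j + v j) ^ 2 := by positivity
  have h2 : 0 ≤ ∑ j, (x j - v j) ^ 2 := by positivity
  constructor <;> linarith

open scoped Pointwise in
lemma vol_eball_two (w : ℕ) : volume (eball w 2) = ENNReal.ofReal (2 ^ w) * volume (eball w 1) := by
  have h : eball w 2 = (2 : ℝ) • eball w 1 := by
    ext u
    rw [Set.mem_smul_set_iff_inv_smul_mem₀ two_ne_zero]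
    simp only [eball, Set.mem_ofPred_eq, Pi.smul_apply, smul_eq_mul, mul_pow, ← Finset.mul_sum]
    constructor <;> intro h <;> linarith
  rw [h, Measure.addHaar_smul]
  simp

lemma vol_eball_ne_top (w : ℕ) : volume (eball w 1) ≠ ∞ := by
  have h : eball w 1 ⊆ Metric.closedBall 0 1 := by
    intro u hu
    rw [mem_closedBall_zero_iff, pi_norm_le_iff_of_nonneg zero_le_one]
    intro j
    have : u j ^ 2 ≤ 1 ^ 2 :=
      (Finset.single_le_sum (f := fun j => u j ^ 2) (fun i _ => sq_nonneg _)
        (Finset.mem_univ j)).trans hu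
    rw [Real.norm_eq_abs]
    exact abs_le_of_sq_le_sq this zero_le_one
  exact ((measure_mono h).trans_lt measure_closedBall_lt_top).ne

lemma vol_eball_ne_zero (w : ℕ) : volume (eball w 1) ≠ 0 := by
  have ho : IsOpen {u : Fin w → ℝ | ∑ j, u j ^ 2 < 1} :=
    isOpen_lt (by fun_prop) continuous_const
  have := ho.measure_pos volume ⟨0, by simp⟩
  refine (this.trans_le (measure_mono ?_)).ne'
  intro u hu
  simp only [eball, Set.mem_ofPred_eq] at *
  linarith

lemma qf_par {d w : ℕ} (A : Fin d → Fin w → ℝ) (x v : Fin w → ℝ) :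
    2 * qf A x ≤ qf A (x + v) + qf A (x - v) := by
  unfold qf
  rw [Finset.mul_sum, ← Finset.sum_add_distrib]
  refine Finset.sum_le_sum fun i _ => ?_
  simp only [Pi.add_apply, Pi.sub_apply, mul_add, mul_sub, Finset.sum_add_distrib,
    Finset.sum_sub_distrib]
  nlinarith [sq_nonneg (∑ j, A i j * v j)]

lemma meas_qf {d w : ℕ} : Measurable (fun q : (Fin d → Fin w → ℝ) × (Fin w → ℝ) => qf q.1 q.2) := by
  unfold qf; fun_prop

lemma opF {d w : ℕ} (A : Fin d → Fin w → ℝ) (x : Fin w → ℝ) (hx : x ∈ eball w 1) (r : ℝ)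
    (h : r ≤ qf A x / 16) :
    ENNReal.ofReal (Real.exp r) * volume (eball w 1) ≤
      ∫⁻ u, (eball w 2).indicator (fun u => ENNReal.ofReal (Real.exp (qf A u / 16))) u := by
  set g := (eball w 2).indicator (fun u => ENNReal.ofReal (Real.exp (qf A u / 16))) with hg
  have hq : Measurable (qf A) := by unfold qf; fun_prop
  have hgm : Measurable g := Measurable.indicator (by fun_prop) (meas_eball w 2)
  have h1 : 2 * (ENNReal.ofReal (Real.exp r) * volume (eball w 1)) ≤ 2 * ∫⁻ u, g u := by
    calc _ = ∫⁻ v in eball w 1, 2 * ENNReal.ofReal (Real.exp r) := by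
          rw [setLIntegral_const, mul_assoc]
      _ ≤ ∫⁻ v in eball w 1, (g (x + v) + g (x - v)) := by
          refine setLIntegral_mono (by fun_prop) fun v hv => ?_
          obtain ⟨m1, m2⟩ := eball_add hx hv
          rw [hg, Set.indicator_of_mem m1, Set.indicator_of_mem m2,
            ← ENNReal.ofReal_add (Real.exp_pos _).le (Real.exp_pos _).le,
            show (2 : ℝ≥0∞) = ENNReal.ofReal 2 by simp, ← ENNReal.ofReal_mul (by norm_num)]
          apply ENNReal.ofReal_le_ofReal
          have hp := qf_par A x v
          have e1 : Real.exp r ^ 2 ≤ Real.exp (qf A (x + v) / 16) * Real.exp (qf A (x - v) / 16) := by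
            rw [← Real.exp_add, ← Real.exp_nat_mul]
            apply Real.exp_le_exp.2
            push_cast
            linarith
          have p1 := Real.exp_pos (qf A (x + v) / 16)
          have p2 := Real.exp_pos (qf A (x - v) / 16)
          have p3 := Real.exp_pos r
          refine abs_le_of_sq_le_sq' ?_ (by positivity) |>.2
          nlinarith [sq_nonneg (Real.exp (qf A (x + v) / 16) - Real.exp (qf A (x - v) / 16))]
      _ ≤ ∫⁻ v, (g (x + v) + g (x - v)) := setLIntegral_le_lintegral _ _
      _ = 2 * ∫⁻ u, g u := by
          rw [lintegral_add_left (by fun_prop), lintegral_add_left_eq_self,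
            lintegral_sub_left_eq_self, two_mul]
  exact (ENNReal.mul_le_mul_iff_right (by simp) (by simp)).1 h1

lemma tailOp (d w : ℕ) (m : ℝ) (hd : d ≤ m) (hw : w ≤ m) :
    gaussEntries d w {A | ∃ x ∈ eball w 1, 48 * m ≤ qf A x} ≤ ENNReal.ofReal (Real.exp (-m)) := by
  set G : (Fin d → Fin w → ℝ) → (Fin w → ℝ) → ℝ≥0∞ := fun A =>
    (eball w 2).indicator (fun u => ENNReal.ofReal (Real.exp (qf A u / 16))) with hG
  have hGm : Measurable (Function.uncurry G) := by
    have : Function.uncurry G = (Prod.snd ⁻¹' (eball w 2)).indicator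
        (fun q => ENNReal.ofReal (Real.exp (qf q.1 q.2 / 16))) := by
      ext ⟨A, u⟩
      simp [hG, Function.uncurry, Set.indicator]
      rfl
    rw [this]
    have := meas_qf (d := d) (w := w)
    exact Measurable.indicator (by fun_prop) (measurable_snd (meas_eball w 2))
  have hF : Measurable fun A => ∫⁻ u, G A u := hGm.lintegral_prod_right
  set V := volume (eball w 1)
  have hV0 := vol_eball_ne_zero w
  have hV1 := vol_eball_ne_top w
  have hint : ∫⁻ A, (∫⁻ u, G A u) ∂(gaussEntries d w) ≤
      ENNReal.ofReal (Real.exp (d * (1 / 2))) * (ENNReal.ofReal (2 ^ w) * V) := by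
    rw [lintegral_lintegral_swap hGm.aemeasurable]
    calc _ ≤ ∫⁻ u, (eball w 2).indicator (fun _ => ENNReal.ofReal (Real.exp (d * (1 / 2)))) u := by
          refine lintegral_mono fun u => ?_
          by_cases hu : u ∈ eball w 2
          · simp only [hG, Set.indicator_of_mem hu]
            have h4 : (1 / 16 : ℝ) * ∑ j, u j ^ 2 ≤ 1 / 4 := by
              simp only [eball, Set.mem_ofPred_eq] at hu
              linarith
            have h0 := lint_lin u (1 / 16) (by linarith)
            have := lint_pi _ d (fun a : Fin w → ℝ => 1 / 16 * (∑ j, a j * u j) ^ 2) (by fun_prop)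
              (1 / 2) (by rw [h0]; exact ENNReal.ofReal_le_ofReal (num2 h4))
            refine le_trans (le_of_eq ?_) this
            unfold gaussEntries qf
            congr 1; ext A
            rw [← Finset.mul_sum]
            congr 2; ring
          · simp [hG, Set.indicator_of_notMem hu]
      _ = _ := by
          rw [lintegral_indicator_const (meas_eball w 2), vol_eball_two]
  have hmk := (mul_meas_ge_le_lintegral (μ := gaussEntries d w) hF
    (ENNReal.ofReal (Real.exp (3 * m)) * V)).trans hint
  have hsub : {A : Fin d → Fin w → ℝ | ∃ x ∈ eball w 1, 48 * m ≤ qf A x} ⊆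
      {A | ENNReal.ofReal (Real.exp (3 * m)) * V ≤ ∫⁻ u, G A u} := by
    rintro A ⟨x, hx, h⟩
    exact opF A x hx _ (by linarith)
  refine (measure_mono hsub).trans ?_
  set P := gaussEntries d w {A | ENNReal.ofReal (Real.exp (3 * m)) * V ≤ ∫⁻ u, G A u}
  have h5 : V * (ENNReal.ofReal (Real.exp (3 * m)) * P) ≤
      V * (ENNReal.ofReal (Real.exp (d * (1 / 2))) * ENNReal.ofReal (2 ^ w)) := by
    calc _ = ENNReal.ofReal (Real.exp (3 * m)) * V * P := by ring
      _ ≤ _ := hmk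
      _ = _ := by ring
  have h6 := (ENNReal.mul_le_mul_iff_right hV0 hV1).1 h5
  have h7 : ENNReal.ofReal (Real.exp (d * (1 / 2))) * ENNReal.ofReal (2 ^ w) ≤
      ENNReal.ofReal (Real.exp (3 * m)) * ENNReal.ofReal (Real.exp (-m)) := by
    rw [← ENNReal.ofReal_mul (Real.exp_pos _).le, ← ENNReal.ofReal_mul (Real.exp_pos _).le]
    apply ENNReal.ofReal_le_ofReal
    have h2 : (2 : ℝ) ^ w ≤ Real.exp w := by
      have := Real.exp_one_gt_d9
      calc (2 : ℝ) ^ w ≤ Real.exp 1 ^ w := by gcongr; linarith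
        _ = _ := by rw [← Real.exp_nat_mul]; simp
    calc _ ≤ Real.exp (d * (1 / 2)) * Real.exp w := by gcongr
      _ ≤ _ := by
        rw [← Real.exp_add, ← Real.exp_add]
        apply Real.exp_le_exp.2
        have : (0 : ℝ) ≤ d := by positivity
        linarith
  exact (ENNReal.mul_le_mul_iff_right (by simp [Real.exp_pos]) (by simp)).1 (h6.trans h7)

lemma qf_le {d w : ℕ} (A : Fin d → Fin w → ℝ) (K : ℝ) (h : ∀ x ∈ eball w 1, qf A x < K)
    (x : Fin w → ℝ) : qf A x ≤ K * ∑ j, x j ^ 2 := by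
  have hn : 0 ≤ ∑ j, x j ^ 2 := by positivity
  rcases hn.eq_or_lt with h0 | h0
  · have : ∀ j, x j = 0 := by
      intro j
      have := (Finset.sum_eq_zero_iff_of_nonneg fun j _ => sq_nonneg (x j)).1 h0.symm j
        (Finset.mem_univ j)
      exact pow_eq_zero_iff (two_ne_zero) |>.1 this
    simp [qf, this]
  · set t := √(∑ j, x j ^ 2)
    have ht : 0 < t := Real.sqrt_pos.2 h0
    have ht2 : t ^ 2 = ∑ j, x j ^ 2 := Real.sq_sqrt hn
    have e : qf A (fun j => x j / t) = qf A x / t ^ 2 := by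
      simp only [qf, ← mul_div_assoc, ← Finset.sum_div, div_pow]
    have := h (fun j => x j / t) (by
      simp only [eball, Set.mem_ofPred_eq, div_pow, ← Finset.sum_div, ← ht2]
      rw [div_self (by positivity)]; norm_num)
    rw [e, div_lt_iff₀ (by positivity), ht2] at this
    exact this.le

lemma qf_tr {d w : ℕ} (A : Fin d → Fin w → ℝ) (K : ℝ) (hK : 0 ≤ K) (h : ∀ x, qf A x ≤ K * ∑ j, x j ^ 2)
    (e : Fin d → ℝ) (he : ∑ i, e i ^ 2 = 1) : ∑ j, (∑ i, e i * A i j) ^ 2 ≤ K := by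
  set z : Fin w → ℝ := fun j => ∑ i, e i * A i j with hz
  have h1 : ∑ j, z j ^ 2 = ∑ i, e i * ∑ j, A i j * z j := by
    simp_rw [Finset.mul_sum]
    rw [Finset.sum_comm]
    refine Finset.sum_congr rfl fun j _ => ?_
    rw [sq]
    nth_rewrite 1 [hz]
    simp only
    rw [Finset.sum_mul]
    exact Finset.sum_congr rfl fun i _ => by ring
  have h2 := Finset.sum_mul_sq_le_sq_mul_sq Finset.univ e (fun i => ∑ j, A i j * z j)
  rw [← h1, he, one_mul] at h2
  have h3 := h2.trans (h z)
  have hn : 0 ≤ ∑ j, z j ^ 2 := by positivity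
  change ∑ j, z j ^ 2 ≤ K
  rcases hn.eq_or_lt with h0 | h0
  · rw [← h0]
    exact hK
  · nlinarith

lemma proj_bound {d : ℕ} (V : Submodule ℝ (EuclideanSpace ℝ (Fin d))) {n : ℕ}
    (e : OrthonormalBasis (Fin n) ℝ V) (m u : EuclideanSpace ℝ (Fin d)) (hu : u ∈ V) :
    ‖m‖ ^ 2 - ∑ l, (inner ℝ (e l : EuclideanSpace ℝ (Fin d)) m) ^ 2 ≤ ‖m - u‖ ^ 2 := by
  have h1 : ∑ l, (inner ℝ (e l : EuclideanSpace ℝ (Fin d)) m) ^ 2 =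
      ‖V.orthogonalProjectionOnto m‖ ^ 2 := by
    rw [← e.sum_sq_norm_inner_right]
    refine Finset.sum_congr rfl fun l _ => ?_
    rw [Real.norm_eq_abs, sq_abs, Submodule.inner_orthogonalProjectionOnto_eq_of_mem_left]
  have h2 := Submodule.norm_sq_eq_add_norm_sq_projection m V
  have h3 := Submodule.norm_sq_eq_add_norm_sq_projection (m - u) V
  have h4 : Vᗮ.orthogonalProjectionOnto u = 0 := by
    rw [Submodule.orthogonalProjectionOnto_eq_zero_iff]
    exact V.le_orthogonal_orthogonal hu
  rw [map_sub Vᗮ.orthogonalProjectionOnto, h4, sub_zero] at h3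
  rw [h1, h2, h3]
  nlinarith [sq_nonneg ‖V.orthogonalProjectionOnto (m - u)‖]

lemma det_bound {d w k : ℕ} (A B : Fin d → Fin w → ℝ) (K : ℝ) (hK : 0 ≤ K)
    (hA : ∀ x, qf A x ≤ K * ∑ j, x j ^ 2) (hB : ∀ x, qf B x ≤ K * ∑ j, x j ^ 2)
    (U : Matrix (Fin d) (Fin d) ℝ) (hU : U.rank ≤ k) :
    frobSq (Matrix.of A * (Matrix.of B)ᵀ) - k * K ^ 2 ≤
      frobSq (Matrix.of A * (Matrix.of B)ᵀ - U) := by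
  set M := Matrix.of A * (Matrix.of B)ᵀ with hM
  set V : Submodule ℝ (EuclideanSpace ℝ (Fin d)) :=
    (Submodule.span ℝ (Set.range U.col)).map
      ((WithLp.linearEquiv 2 ℝ (Fin d → ℝ)).symm : (Fin d → ℝ) →ₗ[ℝ] _) with hV
  have hr : Module.finrank ℝ V = U.rank := by
    rw [hV, LinearEquiv.finrank_map_eq, Matrix.rank_eq_finrank_span_cols]
  set e := stdOrthonormalBasis ℝ V
  have hcol : ∀ j, (WithLp.toLp 2 (U.col j) : EuclideanSpace ℝ (Fin d)) ∈ V := fun j =>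
    Submodule.mem_map_of_mem (Submodule.subset_span ⟨j, rfl⟩)
  have h1 := fun j => proj_bound V e (WithLp.toLp 2 (M.col j)) _ (hcol j)
  have h2 := Finset.sum_le_sum fun j (_ : j ∈ Finset.univ) => h1 j
  rw [Finset.sum_sub_distrib, Finset.sum_comm] at h2
  have f1 : frobSq M = ∑ j, ‖(WithLp.toLp 2 (M.col j) : EuclideanSpace ℝ (Fin d))‖ ^ 2 := by
    simp only [frobSq, EuclideanSpace.real_norm_sq_eq]
    rw [Finset.sum_comm]
    rfl
  have f2 : frobSq (M - U) = ∑ j, ‖(WithLp.toLp 2 (M.col j) : EuclideanSpace ℝ (Fin d)) -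
      WithLp.toLp 2 (U.col j)‖ ^ 2 := by
    simp only [frobSq, EuclideanSpace.real_norm_sq_eq]
    rw [Finset.sum_comm]
    rfl
  rw [f1, f2]
  refine le_trans ?_ h2
  have h3 : ∀ l, ∑ j, (inner ℝ (e l : EuclideanSpace ℝ (Fin d)) (WithLp.toLp 2 (M.col j))) ^ 2
      ≤ K ^ 2 := by
    intro l
    set v : Fin d → ℝ := fun i => (e l : EuclideanSpace ℝ (Fin d)) i with hv
    have hv1 : ∑ i, v i ^ 2 = 1 := by
      have : ‖(e l : EuclideanSpace ℝ (Fin d))‖ ^ 2 = 1 := by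
        have := e.orthonormal.1 l
        rw [← Submodule.coe_norm, this]; norm_num
      rw [EuclideanSpace.real_norm_sq_eq] at this
      exact this
    have g1 := qf_tr A K hK hA v hv1
    have g2 := hB (fun j => ∑ i, v i * A i j)
    have g3 : qf B (fun j => ∑ i, v i * A i j) =
        ∑ j, (inner ℝ (e l : EuclideanSpace ℝ (Fin d)) (WithLp.toLp 2 (M.col j))) ^ 2 := by
      unfold qf
      refine Finset.sum_congr rfl fun j _ => ?_
      congr 1
      simp only [PiLp.inner_apply, Matrix.col, hM, Matrix.mul_apply, Matrix.transpose_apply,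
        Matrix.of_apply, RCLike.inner_apply, conj_trivial, Finset.mul_sum, Finset.sum_mul]
      rw [Finset.sum_comm]
      refine Finset.sum_congr rfl fun i _ => Finset.sum_congr rfl fun l _ => ?_
      ring
    rw [← g3]
    nlinarith
  have h4 := Finset.sum_le_sum fun l (_ : l ∈ Finset.univ) => h3 l
  rw [Finset.sum_const, Finset.card_univ, Fintype.card_fin, nsmul_eq_mul] at h4
  have h5 : (Module.finrank ℝ V : ℝ) * K ^ 2 ≤ k * K ^ 2 := by
    have : (Module.finrank ℝ V : ℝ) ≤ k := by exact_mod_cast hr.le.trans hU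
    gcongr
  linarith

/-- No low-rank approximation of a Gaussian product: there are universal constants `C, c > 0`
such that for independent `d × w` standard Gaussian matrices `A, B` and any
`k ≤ c d² w / max(d,w)²`,
`P[min_{rank(U) ≤ k} ‖ABᵀ − U‖_F² < d²w/2] ≤ C exp(−c min(d,w))`. -/
theorem gaussian_product_low_rank_inapprox :
    ∃ C c : ℝ, 0 < C ∧ 0 < c ∧
      ∀ d w k : ℕ, (k : ℝ) ≤ c * (d : ℝ) ^ 2 * w / max (d : ℝ) (w : ℝ) ^ 2 →
        ((gaussEntries d w).prod (gaussEntries d w))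
            {q | ∃ U : Matrix (Fin d) (Fin d) ℝ, U.rank ≤ k ∧
              frobSq (Matrix.of q.1 * (Matrix.of q.2)ᵀ - U) < (d : ℝ) ^ 2 * w / 2} ≤
          ENNReal.ofReal (C * Real.exp (-c * min (d : ℝ) (w : ℝ))) := by
  refine ⟨4, 1 / 100000, by norm_num, by norm_num, fun d w k hk => ?_⟩
  set m : ℝ := max (d : ℝ) (w : ℝ) with hm
  set n : ℝ := min (d : ℝ) (w : ℝ) with hn
  set μ := gaussEntries d w with hμ
  set ε := ENNReal.ofReal (Real.exp (-(1 / 100000) * n)) with hε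
  have hd0 : (0 : ℝ) ≤ d := by positivity
  have hw0 : (0 : ℝ) ≤ w := by positivity
  have hn0 : 0 ≤ n := le_min hd0 hw0
  have hnd : n ≤ d := min_le_left _ _
  have hdm : (d : ℝ) ≤ m := le_max_left _ _
  have hwm : (w : ℝ) ≤ m := le_max_right _ _
  set E : Set (Fin d → Fin w → ℝ) := {A | ∃ x ∈ eball w 1, 48 * m ≤ qf A x}
  set F : Set (Fin d → Fin w → ℝ) := {A | ∑ i, ∑ j, A i j ^ 2 < 0.8 * (d * w)}
  set H : Set ((Fin d → Fin w → ℝ) × (Fin d → Fin w → ℝ)) :=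
    {q | ∑ i, ∑ j, (∑ l, q.2 j l * q.1 i l) ^ 2 < 0.8 * d * ∑ i, ∑ j, q.1 i j ^ 2}
  have bE : μ E ≤ ε := (tailOp d w m hdm hwm).trans
    (ENNReal.ofReal_le_ofReal (Real.exp_le_exp.2 (by linarith)))
  have hdw : n ≤ d * w := by
    rcases Nat.eq_zero_or_pos w with h | h
    · have : n ≤ w := min_le_right _ _
      subst h; simpa using this
    · have : (1 : ℝ) ≤ w := by exact_mod_cast h
      nlinarith
  have bF : μ F ≤ ε := (tailF d w).trans
    (ENNReal.ofReal_le_ofReal (Real.exp_le_exp.2 (by linarith)))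
  have bH : (μ.prod μ) H ≤ ε := by
    have hHm : MeasurableSet H := measurableSet_lt (by fun_prop) (by fun_prop)
    rw [Measure.prod_apply hHm]
    calc _ ≤ ∫⁻ _, ε ∂μ := by
          refine lintegral_mono fun A => ?_
          exact (tailX d w A).trans
            (ENNReal.ofReal_le_ofReal (Real.exp_le_exp.2 (by linarith)))
      _ = ε := by simp
  have hsub : {q : (Fin d → Fin w → ℝ) × (Fin d → Fin w → ℝ) |
      ∃ U : Matrix (Fin d) (Fin d) ℝ, U.rank ≤ k ∧
        frobSq (Matrix.of q.1 * (Matrix.of q.2)ᵀ - U) < (d : ℝ) ^ 2 * w / 2} ⊆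
      ((E ×ˢ Set.univ) ∪ (Set.univ ×ˢ E)) ∪ ((F ×ˢ Set.univ) ∪ H) := by
    rintro ⟨A, B⟩ ⟨U, hU, hlt⟩
    by_contra hc
    simp only [Set.mem_union, Set.mem_prod, Set.mem_univ, and_true, true_and, not_or] at hc
    obtain ⟨⟨hA, hB⟩, hF, hH⟩ := hc
    simp only [E, F, H, Set.mem_ofPred_eq, not_exists, not_and, not_lt, not_le] at hA hB hF hH
    have hK : 0 ≤ 48 * m := by linarith
    have h1 := det_bound A B (48 * m) hK (qf_le A _ hA) (qf_le B _ hB) U hU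
    have h2 : frobSq (Matrix.of A * (Matrix.of B)ᵀ) = ∑ i, ∑ j, (∑ l, B j l * A i l) ^ 2 := by
      simp only [frobSq, Matrix.mul_apply, Matrix.transpose_apply, Matrix.of_apply]
      simp_rw [mul_comm]
    have h3 : 0.8 * d * (0.8 * (d * w)) ≤ 0.8 * d * ∑ i, ∑ j, A i j ^ 2 := by gcongr
    have h4 : (k : ℝ) * m ^ 2 ≤ 1 / 100000 * (d : ℝ) ^ 2 * w := by
      rcases (hd0.trans hdm).eq_or_lt with h | h
      · rw [← h]; simp; positivity
      · rwa [le_div_iff₀ (by positivity)] at hk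
    have h5 : 0 ≤ (d : ℝ) ^ 2 * w := by positivity
    simp only at hlt
    rw [h2] at h1
    nlinarith
  refine (measure_mono hsub).trans ?_
  have u1 := measure_union_le (μ := μ.prod μ) ((E ×ˢ Set.univ) ∪ (Set.univ ×ˢ E)) ((F ×ˢ Set.univ) ∪ H)
  have u2 := measure_union_le (μ := μ.prod μ) (E ×ˢ Set.univ) (Set.univ ×ˢ E)
  have u3 := measure_union_le (μ := μ.prod μ) (F ×ˢ Set.univ) H
  simp only [Measure.prod_prod, measure_univ, mul_one, one_mul] at u2 u3
  calc _ ≤ (ε + ε) + (ε + ε) :=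
        u1.trans (add_le_add (u2.trans (add_le_add bE bE)) (u3.trans (add_le_add bF bH)))
    _ = _ := by
      rw [ENNReal.ofReal_mul (by norm_num), ← hε]
      norm_num
      ring

end
end
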